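/- arXiv:1508.03187 — 2 statements merged into one kernel-verified Lean document; each statement's English description precedes it below -/
import Mathlib

section
/- There exists a set E ⊆ ℝ² such that: E is countable; E is closed in the Sorgenfrey plane 𝕊²; E is discrete in the subspace topology inherited from 𝕊²; E is a Gδ-set in the Euclidean topology of ℝ²; and E is not C*-embedded in 𝕊². -/
open Topology Set

/-- The Sorgenfrey topology on ℝ, generated by half-open intervals `[a, b)`. -/
def sorgTop : TopologicalSpace ℝ :=
  TopologicalSpace.generateFrom {s : Set ℝ | ∃ a b : ℝ, s = Set.Ico a b}

/-- The Sorgenfrey plane topology on ℝ × ℝ: the product of two Sorgenfrey topologies. -/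
def sorgPlane : TopologicalSpace (ℝ × ℝ) := @instTopologicalSpaceProd ℝ ℝ sorgTop sorgTop

/-- `A` and `B` are completely separated in `(X, t)`. -/
def CompletelySeparatedIn {X : Type*} (t : TopologicalSpace X) (A B : Set X) : Prop :=
  ∃ f : X → ℝ, Continuous[t, inferInstance] f ∧ (∀ x, f x ∈ Set.Icc (0:ℝ) 1) ∧
    (∀ x ∈ A, f x = 0) ∧ (∀ x ∈ B, f x = 1)

/-- `A` is functionally closed (a zero-set) in `(X, t)`. -/
def FunctionallyClosedIn {X : Type*} (t : TopologicalSpace X) (A : Set X) : Prop :=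
  ∃ f : X → ℝ, Continuous[t, inferInstance] f ∧ (∀ x, f x ∈ Set.Icc (0:ℝ) 1) ∧
    A = f ⁻¹' {0}

/-- `E` is C*-embedded in `(X, t)`: every bounded continuous real function on `E`
(with the subspace topology) extends continuously to `X`. -/
def CStarEmbedded {X : Type*} (t : TopologicalSpace X) (E : Set X) : Prop :=
  ∀ f : E → ℝ, Continuous[t.induced ((↑) : E → X), inferInstance] f →
    (∃ M : ℝ, ∀ x, |f x| ≤ M) →
    ∃ g : X → ℝ, Continuous[t, inferInstance] g ∧ ∀ x : E, g x = f x

/-- `E` is C-embedded in `(X, t)`: every continuous real function on `E`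
(with the subspace topology) extends continuously to `X`. -/
def CEmbedded {X : Type*} (t : TopologicalSpace X) (E : Set X) : Prop :=
  ∀ f : E → ℝ, Continuous[t.induced ((↑) : E → X), inferInstance] f →
    ∃ g : X → ℝ, Continuous[t, inferInstance] g ∧ ∀ x : E, g x = f x

/-- `E` is z-embedded in `(X, t)`: every functionally closed subset of `E` is the trace
on `E` of a functionally closed subset of `X`. -/
def ZEmbedded {X : Type*} (t : TopologicalSpace X) (E : Set X) : Prop :=
  ∀ Z : Set E, FunctionallyClosedIn (t.induced ((↑) : E → X)) Z →
    ∃ W : Set X, FunctionallyClosedIn t W ∧ ((↑) : E → X) ⁻¹' W = Z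

/-- The basic Sorgenfrey neighbourhood of `p`: a square with lower left corner `p`. -/
def sorgBox (p : ℝ × ℝ) (δ : ℝ) : Set (ℝ × ℝ) :=
  Ico p.1 (p.1 + δ) ×ˢ Ico p.2 (p.2 + δ)

lemma mem_sorgBox_self {p : ℝ × ℝ} {δ : ℝ} (hδ : 0 < δ) : p ∈ sorgBox p δ := by
  simp [sorgBox, mem_prod, hδ]

lemma sorgBox_mono {p : ℝ × ℝ} {δ ε : ℝ} (h : δ ≤ ε) : sorgBox p δ ⊆ sorgBox p ε := by
  rintro x ⟨⟨h1, h2⟩, h3, h4⟩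
  exact ⟨⟨h1, by linarith⟩, h3, by linarith⟩

lemma sorgBox_subset_ball (p : ℝ × ℝ) (δ : ℝ) : sorgBox p δ ⊆ Metric.ball p δ := by
  rintro x ⟨⟨h1, h2⟩, h3, h4⟩
  rw [Metric.mem_ball, Prod.dist_eq, max_lt_iff, Real.dist_eq, Real.dist_eq, abs_lt, abs_lt]
  refine ⟨⟨?_, ?_⟩, ?_, ?_⟩ <;> linarith

lemma exists_Ico_subset_of_isOpen_sorgTop {U : Set ℝ} (hU : IsOpen[sorgTop] U) {x : ℝ}
    (hx : x ∈ U) : ∃ δ > 0, Ico x (x + δ) ⊆ U := by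
  induction hU with
  | basic s hs =>
    obtain ⟨a, b, rfl⟩ := hs
    exact ⟨b - x, by linarith [hx.2], fun y hy => ⟨hx.1.trans hy.1, by linarith [hy.2]⟩⟩
  | univ => exact ⟨1, one_pos, subset_univ _⟩
  | inter s t _ _ ihs iht =>
    obtain ⟨δ, hδ, hs⟩ := ihs hx.1
    obtain ⟨ε, hε, ht⟩ := iht hx.2
    refine ⟨min δ ε, lt_min hδ hε, fun y hy => ⟨hs ⟨hy.1, ?_⟩, ht ⟨hy.1, ?_⟩⟩⟩
    · linarith [hy.2, min_le_left δ ε]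
    · linarith [hy.2, min_le_right δ ε]
  | sUnion S _ ih =>
    obtain ⟨s, hs, hxs⟩ := hx
    obtain ⟨δ, hδ, h⟩ := ih s hs hxs
    exact ⟨δ, hδ, h.trans (subset_sUnion_of_mem hs)⟩

lemma isOpen_sorgBox (p : ℝ × ℝ) (δ : ℝ) : IsOpen[sorgPlane] (sorgBox p δ) := by
  have h (a b : ℝ) : IsOpen[sorgTop] (Ico a b) :=
    TopologicalSpace.isOpen_generateFrom_of_mem ⟨a, b, rfl⟩
  exact @IsOpen.prod ℝ ℝ sorgTop sorgTop _ _ (h _ _) (h _ _)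

lemma isOpen_sorgPlane_iff {U : Set (ℝ × ℝ)} :
    IsOpen[sorgPlane] U ↔ ∀ p ∈ U, ∃ δ > 0, sorgBox p δ ⊆ U := by
  constructor
  · rintro hU ⟨a, b⟩ hp
    obtain ⟨V, W, hV, hW, ha, hb, hVW⟩ := (@isOpen_prod_iff ℝ ℝ sorgTop sorgTop U).1 hU a b hp
    obtain ⟨δ, hδ, hs⟩ := exists_Ico_subset_of_isOpen_sorgTop hV ha
    obtain ⟨ε, hε, ht⟩ := exists_Ico_subset_of_isOpen_sorgTop hW hb
    refine ⟨min δ ε, lt_min hδ hε, fun x hx => hVW ⟨hs ?_, ht ?_⟩⟩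
    · exact (sorgBox_mono (min_le_left δ ε) hx).1
    · exact (sorgBox_mono (min_le_right δ ε) hx).2
  · intro h
    refine (@isOpen_iff_forall_mem_open _ sorgPlane U).2 fun p hp => ?_
    obtain ⟨δ, hδ, hs⟩ := h p hp
    exact ⟨_, hs, isOpen_sorgBox p δ, mem_sorgBox_self hδ⟩

/-- A locally finite set is closed. -/
lemma isClosed_sorgPlane_of_locally_finite {E : Set (ℝ × ℝ)}
    (h : ∀ p, ∃ δ > 0, (E ∩ sorgBox p δ).Finite) : IsClosed[sorgPlane] E := by
  refine (@isOpen_compl_iff _ E sorgPlane).1 (isOpen_sorgPlane_iff.2 fun p hp => ?_)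
  obtain ⟨δ, hδ, hfin⟩ := h p
  obtain ⟨ε, hε, hb⟩ := Metric.isOpen_iff.1 hfin.isClosed.isOpen_compl p fun hx => hp hx.1
  refine ⟨min δ ε, lt_min hδ hε, fun x hx hxE => ?_⟩
  exact hb (sorgBox_subset_ball _ _ (sorgBox_mono (min_le_right δ ε) hx))
    ⟨hxE, sorgBox_mono (min_le_left δ ε) hx⟩

section Staircase

variable {ι : Type*} {u w : ι → ℝ} {h : ℝ → ℝ}

/-- The points half way up the vertical jumps (of sizes `w i`, at the abscissas `u i`) of the
graph of a decreasing function `h`. -/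
noncomputable def jumpMidpoint (u w : ι → ℝ) (h : ℝ → ℝ) (i : ι) : ℝ × ℝ := (u i, h (u i) + w i / 2)

lemma jumpMidpoint_injective (hu : u.Injective) : (jumpMidpoint u w h).Injective :=
  fun _ _ hij => hu (congrArg Prod.fst hij)

lemma finite_setOf_le_of_summable (hw : Summable w) {c : ℝ} (hc : 0 < c) :
    {i | c ≤ w i}.Finite := by
  have := hw.tendsto_cofinite_zero.eventually (gt_mem_nhds hc)
  simpa [Filter.eventually_cofinite] using this

lemma jumpMidpoint_locally_finite (hu : u.Injective) (hw0 : ∀ i, 0 < w i) (hw : Summable w)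
    (hjump : ∀ i x, x < u i → h (u i) + w i ≤ h x) (hanti : Antitone h)
    (hcont : ∀ x, ContinuousWithinAt h (Ici x) x) (p : ℝ × ℝ) :
    ∃ δ > 0, (range (jumpMidpoint u w h) ∩ sorgBox p δ).Finite := by
  rcases lt_trichotomy p.2 (h p.1) with hp | hp | hp
  · set m := (p.2 + h p.1) / 2 with hm
    have hev : ∀ᶠ x in 𝓝[≥] p.1, m < h x := (hcont p.1).eventually (lt_mem_nhds (by linarith))
    obtain ⟨b, hb, hsub⟩ := (mem_nhdsGE_iff_exists_Ico_subset).1 hev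
    refine ⟨min (b - p.1) (m - p.2), lt_min (sub_pos.2 hb) (by linarith), ?_⟩
    convert Set.finite_empty
    refine eq_empty_of_forall_notMem ?_
    rintro _ ⟨⟨i, rfl⟩, ⟨h1, h2⟩, h3, h4⟩
    simp only [jumpMidpoint] at h1 h2 h3 h4
    have := min_le_left (b - p.1) (m - p.2)
    have := min_le_right (b - p.1) (m - p.2)
    have h5 : m < h (u i) := hsub ⟨h1, by linarith⟩
    linarith [hw0 i]
  · refine ⟨1, one_pos, ?_⟩
    refine ((Set.Subsingleton.finite (s := {i | u i = p.1})
      fun i hi j hj => hu (hi.trans hj.symm)).image (jumpMidpoint u w h)).subset ?_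
    rintro _ ⟨⟨i, rfl⟩, ⟨h1, h2⟩, h3, h4⟩
    refine ⟨i, ?_, rfl⟩
    simp only [jumpMidpoint] at h1 h3
    by_contra hne
    have := hjump i p.1 (lt_of_le_of_ne h1 (Ne.symm hne))
    linarith [hw0 i]
  · refine ⟨1, one_pos, ?_⟩
    refine ((finite_setOf_le_of_summable hw (sub_pos.2 hp)).image (jumpMidpoint u w h)).subset ?_
    rintro _ ⟨⟨i, rfl⟩, ⟨h1, h2⟩, h3, h4⟩
    refine ⟨i, ?_, rfl⟩
    simp only [jumpMidpoint] at h1 h3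
    have := hanti h1
    have := hw0 i
    simp only [mem_ofPred_eq]
    linarith

lemma isClosed_of_subset_range_jumpMidpoint (hu : u.Injective) (hw0 : ∀ i, 0 < w i)
    (hw : Summable w) (hjump : ∀ i x, x < u i → h (u i) + w i ≤ h x) (hanti : Antitone h)
    (hcont : ∀ x, ContinuousWithinAt h (Ici x) x) {A : Set (ℝ × ℝ)}
    (hA : A ⊆ range (jumpMidpoint u w h)) : IsClosed[sorgPlane] A := by
  refine isClosed_sorgPlane_of_locally_finite fun p => ?_
  obtain ⟨δ, hδ, hfin⟩ := jumpMidpoint_locally_finite hu hw0 hw hjump hanti hcont p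
  exact ⟨δ, hδ, hfin.subset (inter_subset_inter_left _ hA)⟩

lemma isGδ_range_jumpMidpoint (hu : u.Injective) (hw0 : ∀ i, 0 < w i)
    (hjump : ∀ i x, x < u i → h (u i) + w i ≤ h x) :
    IsGδ (range (jumpMidpoint u w h)) := by
  set O : ι → Set (ℝ × ℝ) := fun i => Prod.snd ⁻¹' Ioo (h (u i)) (h (u i) + w i)
  have hOopen (i) : IsOpen (O i) := isOpen_Ioo.preimage continuous_snd
  have hmem (i) : jumpMidpoint u w h i ∈ O i := by
    have := hw0 i
    constructor <;> simp only [jumpMidpoint] <;> linarith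
  have huniq {i j p} (hi : p ∈ O i) (hj : p ∈ O j) : u i = u j := by
    obtain ⟨h1, h2⟩ := hi
    obtain ⟨h3, h4⟩ := hj
    rcases lt_trichotomy (u i) (u j) with hij | hij | hij
    · linarith [hjump j _ hij]
    · exact hij
    · linarith [hjump i _ hij]
  have key : range (jumpMidpoint u w h) =
      ⋂ n : ℕ, ⋃ i, O i ∩ Metric.ball (jumpMidpoint u w h i) (1 / (n + 1 : ℝ)) := by
    ext p
    simp only [mem_iInter, mem_iUnion]
    constructor
    · rintro ⟨i, rfl⟩ n
      exact ⟨i, hmem i, Metric.mem_ball_self Nat.one_div_pos_of_nat⟩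
    · intro hp
      obtain ⟨i, hi, -⟩ := hp 0
      refine ⟨i, (eq_of_forall_dist_le fun ε hε => ?_).symm⟩
      obtain ⟨n, hn⟩ := exists_nat_one_div_lt hε
      obtain ⟨j, hj, hpj⟩ := hp n
      obtain rfl := hu (huniq hi hj)
      exact ((Metric.mem_ball.1 hpj).trans hn).le
  rw [key]
  exact IsGδ.iInter_of_isOpen fun n => isOpen_iUnion fun i => (hOopen i).inter Metric.isOpen_ball

/-- If the jumps of `h` in two complementary classes are both dense, then no Sorgenfrey-continuous
function separates the midpoints of the jumps in the two classes. -/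
lemma jumpMidpoint_not_separated {c : ι → Prop}
    (hw0 : ∀ i, 0 < w i) (hw : Summable w) (hanti : Antitone h)
    (hcont : ∀ x, ContinuousWithinAt h (Ici x) x)
    (hd1 : Dense (u '' {i | c i})) (hd0 : Dense (u '' {i | ¬ c i}))
    {g : ℝ × ℝ → ℝ} (hg : Continuous[sorgPlane, inferInstance] g)
    (hg1 : ∀ i, c i → g (jumpMidpoint u w h i) = 1)
    (hg0 : ∀ i, ¬ c i → g (jumpMidpoint u w h i) = 0) : False := by
  have hopen {V : Set ℝ} (hV : IsOpen V) : IsOpen[sorgPlane] (g ⁻¹' V) :=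
    (@continuous_def _ _ sorgPlane _ g).1 hg V hV
  set S : Set ℝ → ℕ → Set ℝ := fun V n => {x | sorgBox (x, h x) (1 / (n + 1 : ℝ)) ⊆ g ⁻¹' V}
  have hmeet {V W : Set ℝ} (hVW : Disjoint V W) (hW : IsOpen W) {d : Set ι}
      (hd : Dense (u '' d)) (hgd : ∀ i ∈ d, g (jumpMidpoint u w h i) ∈ W) (n : ℕ) :
      interior (closure (S V n)) = ∅ := by
    by_contra hne
    have hc : (0 : ℝ) < 1 / (n + 1 : ℝ) := Nat.one_div_pos_of_nat
    have hfin := (finite_setOf_le_of_summable hw hc).image u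
    obtain ⟨_, hint, ⟨i, hi, rfl⟩, hsmall⟩ := (hd.sdiff_finite hfin).inter_open_nonempty _
      isOpen_interior (nonempty_iff_ne_empty.2 hne)
    have hwi : w i < 1 / (n + 1 : ℝ) := by
      by_contra hle
      exact hsmall ⟨i, not_lt.1 hle, rfl⟩
    obtain ⟨r, hr, hsub⟩ := isOpen_sorgPlane_iff.1 (hopen hW) _ (hgd i hi)
    have hev : ∀ᶠ x in 𝓝[≥] (u i), h (u i) - w i / 2 < h x :=
      (hcont (u i)).eventually (lt_mem_nhds (by linarith [hw0 i]))
    obtain ⟨b, hb, hbsub⟩ := mem_nhdsGE_iff_exists_Ico_subset.1 hev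
    have hT : (Ioo (u i) (min b (u i + r)) ∩ interior (closure (S V n))).Nonempty := by
      have hmem : Ioo (u i) (min b (u i + r)) ∈ 𝓝[>] (u i) :=
        Ioo_mem_nhdsGT (lt_min hb (by linarith))
      exact Filter.nonempty_of_mem
        (Filter.inter_mem hmem (mem_nhdsWithin_of_mem_nhds (isOpen_interior.mem_nhds hint)))
    obtain ⟨y, hy, hyS⟩ := hT
    obtain ⟨x, hx, hxS⟩ := mem_closure_iff.1 (interior_subset hyS) _ isOpen_Ioo hy
    have hxb : x < b := hx.2.trans_le (min_le_left _ _)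
    have hxr : x < u i + r := hx.2.trans_le (min_le_right _ _)
    have h1 : h (u i) - w i / 2 < h x := hbsub ⟨hx.1.le, hxb⟩
    have h2 : h x ≤ h (u i) := hanti hx.1.le
    have hwi0 := hw0 i
    have hV : g (x, h (u i) + w i / 2) ∈ V :=
      hxS ⟨⟨le_rfl, by simp only; linarith⟩, by simp only; linarith, by simp only; linarith⟩
    have hW' : g (x, h (u i) + w i / 2) ∈ W :=
      hsub ⟨⟨hx.1.le, hxr⟩, le_rfl, by simp only [jumpMidpoint]; linarith⟩
    exact disjoint_left.1 hVW hV hW'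
  have hcover : ⋃ k : ℕ ⊕ ℕ, closure (k.elim (S (Iio (2 / 3))) (S (Ioi (1 / 3)))) = univ := by
    refine eq_univ_of_forall fun x => ?_
    have hex {V : Set ℝ} (hV : IsOpen V) (hx : g (x, h x) ∈ V) : ∃ n, x ∈ S V n := by
      obtain ⟨δ, hδ, hsub⟩ := isOpen_sorgPlane_iff.1 (hopen hV) _ hx
      obtain ⟨n, hn⟩ := exists_nat_one_div_lt hδ
      exact ⟨n, (sorgBox_mono hn.le).trans hsub⟩
    rcases lt_or_ge (g (x, h x)) (2 / 3) with hx | hx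
    · obtain ⟨n, hn⟩ := hex isOpen_Iio hx
      exact mem_iUnion.2 ⟨Sum.inl n, subset_closure hn⟩
    · obtain ⟨n, hn⟩ := hex (V := Ioi (1 / 3)) isOpen_Ioi (by simp only [mem_Ioi]; linarith)
      exact mem_iUnion.2 ⟨Sum.inr n, subset_closure hn⟩
  obtain ⟨k, hk⟩ := nonempty_interior_of_iUnion_of_closed (fun k => isClosed_closure) hcover
  rcases k with n | n
  · refine hk.ne_empty (hmeet (W := Ioi (2 / 3)) ?_ isOpen_Ioi hd1 (fun i hi => ?_) n)
    · exact disjoint_left.2 fun x hx hx' => by simp only [mem_Iio, mem_Ioi] at hx hx'; linarith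
    · rw [hg1 i hi]; norm_num
  · refine hk.ne_empty (hmeet (W := Iio (1 / 3)) ?_ isOpen_Iio hd0 (fun i hi => ?_) n)
    · exact disjoint_left.2 fun x hx hx' => by simp only [mem_Iio, mem_Ioi] at hx hx'; linarith
    · rw [hg0 i hi]; norm_num

end Staircase

section JumpFunction

variable {ι : Type*} {u w : ι → ℝ}

/-- The decreasing right-continuous pure jump function with jumps `w i` at `u i`. -/
noncomputable def jumpFunction (u w : ι → ℝ) (x : ℝ) : ℝ :=
  -∑' i, (Iic x).indicator (fun _ => w i) (u i)

lemma summable_jump (hw0 : ∀ i, 0 < w i) (hw : Summable w) (x : ℝ) :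
    Summable fun i => (Iic x).indicator (fun _ => w i) (u i) := by
  refine hw.of_nonneg_of_le (fun i => indicator_nonneg (fun _ _ => (hw0 i).le) _) fun i => ?_
  exact indicator_le_self' (f := fun _ => w i) (fun _ _ => (hw0 i).le) _

lemma jumpFunction_antitone (hw0 : ∀ i, 0 < w i) (hw : Summable w) :
    Antitone (jumpFunction u w) := fun x y hxy =>
  neg_le_neg <| (summable_jump hw0 hw x).tsum_le_tsum
    (fun i => indicator_le_indicator_of_subset (Iic_subset_Iic.2 hxy) (fun _ => (hw0 i).le) _)
    (summable_jump hw0 hw y)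

lemma jumpFunction_jump (hw0 : ∀ i, 0 < w i) (hw : Summable w) (i : ι) (x : ℝ) (hx : x < u i) :
    jumpFunction u w (u i) + w i ≤ jumpFunction u w x := by
  classical
  have hle : ∑' j, ((Iic x).indicator (fun _ => w j) (u j) + (Pi.single i (w i) : ι → ℝ) j) ≤
      ∑' j, (Iic (u i)).indicator (fun _ => w j) (u j) := by
    refine Summable.tsum_le_tsum (fun j => ?_)
      ((summable_jump hw0 hw x).add (hasSum_pi_single i (w i)).summable) (summable_jump hw0 hw _)
    by_cases hj : j = i
    · subst hj
      simp [hx]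
    · rw [Pi.single_eq_of_ne hj, add_zero]
      exact indicator_le_indicator_of_subset (Iic_subset_Iic.2 hx.le) (fun _ => (hw0 j).le) _
  rw [(summable_jump hw0 hw x).tsum_add (hasSum_pi_single i (w i)).summable,
    tsum_pi_single] at hle
  simp only [jumpFunction]
  linarith

lemma jumpFunction_continuousWithinAt (hw0 : ∀ i, 0 < w i) (hw : Summable w) (x : ℝ) :
    ContinuousWithinAt (jumpFunction u w) (Ici x) x := by
  refine Filter.Tendsto.neg (tendsto_tsum_of_dominated_convergence hw (fun i => ?_) ?_)
  · refine tendsto_const_nhds.congr' ?_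
    rcases le_or_gt (u i) x with hi | hi
    · filter_upwards [self_mem_nhdsWithin] with y hy
      have : u i ≤ y := hi.trans hy
      simp [hi, this]
    · filter_upwards [mem_nhdsWithin_of_mem_nhds (gt_mem_nhds hi)] with y hy
      simp [not_le.2 hi, not_le.2 hy]
  · refine Filter.Eventually.of_forall fun y i => ?_
    rw [Real.norm_of_nonneg (indicator_nonneg (fun _ _ => (hw0 i).le) _)]
    exact indicator_le_self' (f := fun _ => w i) (fun _ _ => (hw0 i).le) _

end JumpFunction

/-- The points `r` and `r + √2` for rational `r`. -/
noncomputable def ratShift (i : ℚ × Bool) : ℝ := i.1 + if i.2 then √2 else 0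

lemma ratShift_injective : Function.Injective ratShift := by
  have key (r s : ℚ) : (r : ℝ) + √2 ≠ s := fun h =>
    irrational_sqrt_two ⟨s - r, by push_cast; linarith⟩
  rintro ⟨r, _ | _⟩ ⟨s, _ | _⟩ h
  · simpa [ratShift] using h
  · exact (key s r (by simpa [ratShift] using h.symm)).elim
  · exact (key r s (by simpa [ratShift] using h)).elim
  · simpa [ratShift] using h

lemma dense_ratShift_image (b : Bool) : Dense (ratShift '' {i | i.2 = b}) := by
  refine dense_of_exists_between fun {x y} hxy => ?_
  obtain ⟨r, h1, h2⟩ := exists_rat_btwn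
    (sub_lt_sub_right hxy (if b then √2 else 0))
  refine ⟨_, ⟨(r, b), rfl, rfl⟩, ?_, ?_⟩ <;> simp only [ratShift] <;> linarith

/-- There is a countable, Sorgenfrey-closed, Sorgenfrey-discrete, Euclidean-Gδ set
which is not C*-embedded in the Sorgenfrey plane. -/
theorem exists_countable_closed_discrete_Gdelta_not_cstarEmbedded :
    ∃ E : Set (ℝ × ℝ), E.Countable ∧ IsClosed[sorgPlane] E ∧
      (∀ p ∈ E, ∃ U : Set (ℝ × ℝ), IsOpen[sorgPlane] U ∧ U ∩ E = {p}) ∧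
      IsGδ E ∧ ¬ CStarEmbedded sorgPlane E := by
  classical
  set w : ℚ × Bool → ℝ := fun i => (1 / 2) ^ Encodable.encode i
  have hw0 (i) : 0 < w i := by positivity
  have hw : Summable w := summable_geometric_two_encode
  set h := jumpFunction ratShift w
  have hjump := jumpFunction_jump (u := ratShift) hw0 hw
  have hanti := jumpFunction_antitone (u := ratShift) hw0 hw
  have hcont := jumpFunction_continuousWithinAt (u := ratShift) hw0 hw
  set e := jumpMidpoint ratShift w h
  have hclosed {A : Set (ℝ × ℝ)} (hA : A ⊆ range e) : IsClosed[sorgPlane] A :=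
    isClosed_of_subset_range_jumpMidpoint ratShift_injective hw0 hw hjump hanti hcont hA
  have hopen {A : Set (ℝ × ℝ)} (hA : A ⊆ range e) : IsOpen[sorgPlane] Aᶜ :=
    (@isOpen_compl_iff _ A sorgPlane).2 (hclosed hA)
  refine ⟨range e, countable_range e, hclosed subset_rfl, fun p hp => ?_,
    isGδ_range_jumpMidpoint ratShift_injective hw0 hjump, fun hC => ?_⟩
  · refine ⟨(range e \ {p})ᶜ, hopen sdiff_subset, ?_⟩
    ext x
    simp only [mem_inter_iff, mem_compl_iff, mem_sdiff, mem_singleton_iff]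
    constructor
    · tauto
    · rintro rfl
      tauto
  · set f : range e → ℝ := fun x => if (x : ℝ × ℝ) ∈ e '' {i | i.2 = true} then 1 else 0 with hf
    have hfc : Continuous[sorgPlane.induced ((↑) : range e → ℝ × ℝ), inferInstance] f := by
      refine (@continuous_def _ _ (sorgPlane.induced _) _ f).2 fun V _ => ?_
      refine (@isOpen_induced_iff _ _ sorgPlane _ _).2 ⟨(range e \ ((↑) '' (f ⁻¹' V)))ᶜ, hopen sdiff_subset, ?_⟩
      ext x
      simp
    obtain ⟨g, hg, hgf⟩ := hC f hfc ⟨1, fun x => by simp only [hf]; split_ifs <;> simp⟩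
    refine jumpMidpoint_not_separated (c := fun i => i.2 = true) hw0 hw hanti hcont
      (dense_ratShift_image true) (by simpa using dense_ratShift_image false) hg
      (fun i hi => ?_) fun i hi => ?_
    · rw [hgf ⟨e i, mem_range_self i⟩]
      exact if_pos ⟨i, hi, rfl⟩
    · rw [hgf ⟨e i, mem_range_self i⟩]
      refine if_neg ?_
      rintro ⟨j, hj, hji⟩
      exact hi (jumpMidpoint_injective ratShift_injective hji ▸ hj)
end

section
/- Let 𝔻 = {(x, −x) : x ∈ ℝ} be the anti-diagonal of the Sorgenfrey plane 𝕊² and let E ⊆ 𝔻. Then the following conditions are equivalent: (1) E is C-embedded in 𝕊²; (2) E is C*-embedded in 𝕊²; (3) E is countable and E is a Gδ-set in the Euclidean topology of ℝ²; (4) E is countable and E is functionally closed in 𝕊². -/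
open Topology Set

/-- The half-open square with lower left corner `p` and side `ε`. -/
def halfOpenBox (p : ℝ × ℝ) (ε : ℝ) : Set (ℝ × ℝ) :=
  Ico p.1 (p.1 + ε) ×ˢ Ico p.2 (p.2 + ε)

lemma mem_halfOpenBox {p q : ℝ × ℝ} {ε : ℝ} : q ∈ halfOpenBox p ε ↔
    (p.1 ≤ q.1 ∧ q.1 < p.1 + ε) ∧ p.2 ≤ q.2 ∧ q.2 < p.2 + ε := Iff.rfl

lemma self_mem_halfOpenBox (p : ℝ × ℝ) {ε : ℝ} (hε : 0 < ε) : p ∈ halfOpenBox p ε := by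
  simp [mem_halfOpenBox, hε]

lemma eq_of_mem_halfOpenBox_antidiagonal {a b ε : ℝ} (h : (a, -a) ∈ halfOpenBox (b, -b) ε) :
    a = b := by
  rw [mem_halfOpenBox] at h
  dsimp only at h
  linarith [h.1.1, h.2.1]

lemma sorgTop_isOpen_Ico (a b : ℝ) : IsOpen[sorgTop] (Ico a b) :=
  TopologicalSpace.isOpen_generateFrom_of_mem ⟨a, b, rfl⟩

lemma sorgTop_isClosed_Ico (a b : ℝ) : IsClosed[sorgTop] (Ico a b) := by
  let _ := sorgTop
  have h : (Ico a b)ᶜ = (⋃ c, Ico c a) ∪ ⋃ c, Ico b c := by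
    ext x
    simp only [mem_compl_iff, mem_Ico, mem_union, mem_iUnion, not_and_or, not_le, not_lt]
    constructor
    · rintro (h | h)
      · exact Or.inl ⟨x, le_rfl, h⟩
      · exact Or.inr ⟨x + 1, h, lt_add_one x⟩
    · rintro (⟨_, _, h⟩ | ⟨_, h, _⟩)
      exacts [Or.inl h, Or.inr h]
  rw [← isOpen_compl_iff, h]
  exact (isOpen_iUnion fun c => sorgTop_isOpen_Ico c a).union
    (isOpen_iUnion fun c => sorgTop_isOpen_Ico b c)

lemma sorgTop_exists_Ico_subset {U : Set ℝ} (hU : IsOpen[sorgTop] U) {x : ℝ} (hx : x ∈ U) :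
    ∃ ε > 0, Ico x (x + ε) ⊆ U := by
  induction hU with
  | basic s hs =>
    obtain ⟨a, b, rfl⟩ := hs
    exact ⟨b - x, sub_pos.2 hx.2, fun y hy => ⟨hx.1.trans hy.1, by linarith [hy.2]⟩⟩
  | univ => exact ⟨1, one_pos, subset_univ _⟩
  | inter s t _ _ hs ht =>
    obtain ⟨ε, hε, h⟩ := hs hx.1
    obtain ⟨δ, hδ, h'⟩ := ht hx.2
    refine ⟨min ε δ, lt_min hε hδ, fun y hy => ⟨h ⟨hy.1, ?_⟩, h' ⟨hy.1, ?_⟩⟩⟩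
    · linarith [hy.2, min_le_left ε δ]
    · linarith [hy.2, min_le_right ε δ]
  | sUnion S _ ih =>
    obtain ⟨s, hs, hxs⟩ := hx
    obtain ⟨ε, hε, h⟩ := ih s hs hxs
    exact ⟨ε, hε, h.trans (subset_sUnion_of_mem hs)⟩

lemma sorgPlane_isClopen_halfOpenBox (p : ℝ × ℝ) (ε : ℝ) :
    @IsClopen _ sorgPlane (halfOpenBox p ε) := by
  let _ := sorgTop
  exact ⟨(sorgTop_isClosed_Ico _ _).prod (sorgTop_isClosed_Ico _ _),
    (sorgTop_isOpen_Ico _ _).prod (sorgTop_isOpen_Ico _ _)⟩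

lemma sorgPlane_exists_halfOpenBox_subset {U : Set (ℝ × ℝ)} (hU : IsOpen[sorgPlane] U)
    {p : ℝ × ℝ} (hp : p ∈ U) : ∃ ε > 0, halfOpenBox p ε ⊆ U := by
  obtain ⟨u, v, hu, hv, hpu, hpv, huv⟩ :=
    (@isOpen_prod_iff ℝ ℝ sorgTop sorgTop U).1 hU p.1 p.2 hp
  obtain ⟨ε, hε, h⟩ := sorgTop_exists_Ico_subset hu hpu
  obtain ⟨δ, hδ, h'⟩ := sorgTop_exists_Ico_subset hv hpv
  refine ⟨min ε δ, lt_min hε hδ, fun q hq => huv ⟨h ⟨hq.1.1, ?_⟩, h' ⟨hq.2.1, ?_⟩⟩⟩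
  · linarith [hq.1.2, min_le_left ε δ]
  · linarith [hq.2.2, min_le_right ε δ]

lemma functionallyClosedIn_iInter_isClopen {X : Type*} [t : TopologicalSpace X] {U : ℕ → Set X}
    (hU : ∀ n, IsClopen (U n)) : FunctionallyClosedIn t (⋂ n, U n) := by
  set u : ℕ → X → ℝ := fun n => indicator (U n)ᶜ fun _ => (1 / 2 : ℝ) ^ n with hu
  have hnonneg : ∀ n x, 0 ≤ u n x := fun n x => indicator_nonneg (fun _ _ => by positivity) x
  have hle : ∀ n x, ‖u n x‖ ≤ (1 / 2 : ℝ) ^ n := fun n x => by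
    rw [Real.norm_of_nonneg (hnonneg n x)]
    exact indicator_le_self' (fun _ _ => by positivity) x
  have hsum : ∀ x, Summable fun n => u n x := fun x =>
    Summable.of_norm_bounded summable_geometric_two fun n => hle n x
  have hcont : Continuous fun x => ∑' n, u n x := by
    refine continuous_tsum (fun n => ?_) summable_geometric_two hle
    refine continuous_const.indicator fun a ha => ?_
    simp [(hU n).compl.frontier_eq] at ha
  refine ⟨fun x => min 1 (∑' n, u n x), continuous_const.min hcont,
    fun x => ⟨le_min zero_le_one (tsum_nonneg fun n => hnonneg n x), min_le_left _ _⟩, ?_⟩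
  ext x
  simp only [mem_iInter, mem_preimage, mem_singleton_iff]
  constructor
  · intro hx
    have : ∀ n, u n x = 0 := fun n => indicator_of_notMem (by simpa using hx n) _
    simp [this]
  · intro hx n
    by_contra hn
    have hpos : 0 < u n x := by
      simp only [hu]
      rw [indicator_of_mem (by simpa using hn)]
      positivity
    have := (hsum x).tsum_pos (hnonneg · x) n hpos
    exact (lt_min one_pos this).ne' hx

lemma cEmbedded_range_of_isClopen_separated {X : Type*} [t : TopologicalSpace X] {e : ℕ → X}
    {W : ℕ → Set X} (hW : ∀ n, IsClopen (W n)) (heW : ∀ n, e n ∈ W n)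
    (hsep : ∀ m n, e m ∈ W n → e m = e n) (hE : FunctionallyClosedIn t (range e)) :
    CEmbedded t (range e) := by
  intro f _
  obtain ⟨φ, hφ, hφI, hφE⟩ := hE
  obtain ⟨ψ, hψ, hψI, hψW⟩ := functionallyClosedIn_iInter_isClopen fun n => (hW n).compl
  have hφ0 : ∀ x, φ x = 0 ↔ x ∈ range e := fun x => by rw [hφE]; rfl
  have hψ0 : ∀ x, ψ x = 0 ↔ ∀ n, x ∉ W n := fun x => by
    have : x ∈ ⋂ n, (W n)ᶜ ↔ ψ x = 0 := by rw [hψW]; rfl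
    simpa using this.symm
  have hpos : ∀ x, 0 < ψ x + φ x := fun x => by
    refine lt_of_le_of_ne (add_nonneg (hψI x).1 (hφI x).1) fun h => ?_
    have h1 : φ x = 0 := by linarith [(hψI x).1, (hφI x).1]
    have h2 : ψ x = 0 := by linarith [(hψI x).1, (hφI x).1]
    obtain ⟨n, rfl⟩ := (hφ0 x).1 h1
    exact (hψ0 _).1 h2 n (heW n)
  set h : X → ℝ := fun x => max 0 (ψ x - φ x) / (ψ x + φ x) with hh
  have hcont : Continuous h :=
    (continuous_const.max (hψ.sub hφ)).div (hψ.add hφ) fun x => (hpos x).ne'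
  set N : X → ℕ := fun x => sInf {n | x ∈ W n}
  refine ⟨fun x => f ⟨e (N x), mem_range_self _⟩ * h x, ?_, ?_⟩
  · rw [continuous_iff_continuousAt]
    intro x
    by_cases hx : ∃ n, x ∈ W n
    · have hmem : x ∈ W (N x) := Nat.sInf_mem hx
      have hO : IsOpen (W (N x) ∩ ⋂ k ∈ Finset.range (N x), (W k)ᶜ) :=
        (hW _).isOpen.inter (isOpen_biInter_finset fun k _ => (hW k).compl.isOpen)
      have hxO : x ∈ W (N x) ∩ ⋂ k ∈ Finset.range (N x), (W k)ᶜ := by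
        refine ⟨hmem, mem_iInter₂.2 fun k hk hk' => ?_⟩
        exact Nat.notMem_of_lt_sInf (Finset.mem_range.1 hk) hk'
      have hev : ∀ᶠ y in 𝓝 x, N y = N x := by
        filter_upwards [hO.mem_nhds hxO] with y hy
        refine le_antisymm (Nat.sInf_le hy.1) (not_lt.1 fun hlt => ?_)
        exact mem_iInter₂.1 hy.2 (N y) (Finset.mem_range.2 hlt)
          (Nat.sInf_mem (s := {n | y ∈ W n}) ⟨_, hy.1⟩)
      have : ContinuousAt (fun y => f ⟨e (N x), mem_range_self _⟩ * h y) x :=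
        continuousAt_const.mul hcont.continuousAt
      refine this.congr ?_
      filter_upwards [hev] with y hy
      simp only [hy]
    · have hψx : ψ x = 0 := (hψ0 x).2 (not_exists.1 hx)
      have hlt : ψ x < φ x := by linarith [hpos x]
      refine (continuousAt_const (y := (0 : ℝ))).congr ?_
      filter_upwards [(isOpen_lt hψ hφ).mem_nhds hlt] with y hy
      have hy' : ψ y - φ y ≤ 0 := sub_nonpos.2 (le_of_lt hy)
      simp [hh, max_eq_left hy']
  · rintro ⟨_, m, rfl⟩
    have h1 : e m ∈ W (N (e m)) := Nat.sInf_mem (s := {n | e m ∈ W n}) ⟨m, heW m⟩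
    have h2 : φ (e m) = 0 := (hφ0 _).2 ⟨m, rfl⟩
    have h3 : 0 < ψ (e m) := by linarith [hpos (e m)]
    have h4 : h (e m) = 1 := by
      simp only [hh, h2, sub_zero, add_zero, max_eq_right h3.le]
      exact div_self h3.ne'
    simp only [h4, mul_one, ← hsep _ _ h1]

lemma isGδ_antidiagonal_zeroSet {g : ℝ × ℝ → ℝ} (hg : Continuous[sorgPlane, inferInstance] g) :
    IsGδ {x : ℝ | g (x, -x) = 0} := by
  set A : ℕ → Set ℝ := fun n => {x | ∀ q ∈ halfOpenBox (x, -x) (1 / (n + 1)),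
    (1 / (n + 1) : ℝ) ≤ |g q|}
  have habs : Continuous[sorgPlane, inferInstance] fun q => |g q| :=
    @Continuous.abs _ _ _ _ _ _ _ sorgPlane _ hg
  have hEq : {x : ℝ | g (x, -x) = 0} = ⋂ n, (closure (A n))ᶜ := by
    ext a
    simp only [mem_ofPred_eq, mem_iInter, mem_compl_iff]
    constructor
    · intro ha n hmem
      have hn : (0 : ℝ) < 1 / (n + 1) := Nat.one_div_pos_of_nat
      have hopen : IsOpen[sorgPlane] {q | |g q| < 1 / (n + 1)} :=
        (@Continuous.isOpen_preimage _ _ sorgPlane _ _ habs _ isOpen_Iio)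
      obtain ⟨ε, hε, hbox⟩ := sorgPlane_exists_halfOpenBox_subset hopen
        (p := (a, -a)) (by simpa [ha] using hn)
      set s := min ε (1 / (n + 1))
      have hs0 : 0 < s := lt_min hε hn
      obtain ⟨x, hx, hxa⟩ := Metric.mem_closure_iff.1 hmem (s / 2) (by positivity)
      rw [Real.dist_eq, abs_lt] at hxa
      have hs1 : s ≤ ε := min_le_left _ _
      have hs2 : s ≤ 1 / (n + 1) := min_le_right _ _
      have h1 := hbox (a := (a + s / 2, -a + s / 2))
        (mem_halfOpenBox.2 ⟨⟨by dsimp only; linarith, by dsimp only; linarith⟩,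
          by dsimp only; linarith, by dsimp only; linarith⟩)
      have h2 := hx (a + s / 2, -a + s / 2)
        (mem_halfOpenBox.2 ⟨⟨by dsimp only; linarith, by dsimp only; linarith⟩,
          by dsimp only; linarith, by dsimp only; linarith⟩)
      exact absurd h1 (not_lt.2 h2)
    · intro ha
      by_contra hne
      have hpos : 0 < |g (a, -a)| := abs_pos.2 hne
      have hopen : IsOpen[sorgPlane] {q | |g (a, -a)| / 2 < |g q|} :=
        (@Continuous.isOpen_preimage _ _ sorgPlane _ _ habs _ isOpen_Ioi)
      obtain ⟨ε, hε, hbox⟩ := sorgPlane_exists_halfOpenBox_subset hopen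
        (p := (a, -a)) (half_lt_self hpos)
      obtain ⟨n, hn⟩ := exists_nat_one_div_lt (lt_min hε (half_pos hpos))
      refine ha n (subset_closure fun q hq => ?_)
      have hq' : q ∈ halfOpenBox (a, -a) ε := by
        have := hn.trans_le (min_le_left _ _)
        rw [mem_halfOpenBox] at hq ⊢
        exact ⟨⟨hq.1.1, by linarith [hq.1.2]⟩, hq.2.1, by linarith [hq.2.2]⟩
      exact (hn.trans_le (min_le_right _ _)).le.trans (le_of_lt (hbox hq'))
  rw [hEq]
  exact .iInter_of_isOpen fun n => isClosed_closure.isOpen_compl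

lemma sorgPlane_isClopen_iUnion_halfOpenBox {x ε : ℕ → ℝ} (hε : ∀ k, 0 < ε k)
    (hlim : Filter.Tendsto ε Filter.atTop (𝓝 0))
    (hfar : ∀ a ∉ range x, ∀ᶠ k in Filter.atTop, ε k ≤ |x k - a|) :
    @IsClopen _ sorgPlane (⋃ k, halfOpenBox (x k, -x k) (ε k)) := by
  let _ := sorgPlane
  refine ⟨?_, isOpen_iUnion fun k => (sorgPlane_isClopen_halfOpenBox _ _).2⟩
  rw [← isOpen_compl_iff, isOpen_iff_mem_nhds]
  intro p hp
  rw [mem_compl_iff, mem_iUnion, not_exists] at hp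
  have key : ∃ δ > 0, ∀ᶠ k in Filter.atTop,
      ∀ q ∈ halfOpenBox p δ, q ∉ halfOpenBox (x k, -x k) (ε k) := by
    rcases lt_trichotomy (p.1 + p.2) 0 with hs | hs | hs
    · refine ⟨-(p.1 + p.2) / 2, by linarith, .of_forall fun k q hq hq' => ?_⟩
      rw [mem_halfOpenBox] at hq hq'
      dsimp only at hq'
      linarith [hq.1.2, hq.2.2, hq'.1.1, hq'.2.1]
    · have hp2 : p.2 = -p.1 := by linarith
      have hpx : p.1 ∉ range x := by
        rintro ⟨k, hk⟩
        refine hp k ?_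
        have : p = (x k, -x k) := Prod.ext hk.symm (by rw [hp2, hk])
        rw [this]
        exact self_mem_halfOpenBox _ (hε k)
      refine ⟨1, one_pos, (hfar _ hpx).mono fun k hk q hq hq' => ?_⟩
      rw [mem_halfOpenBox] at hq hq'
      dsimp only at hq'
      rcases le_abs.1 hk with h | h
      · linarith [hq.2.1, hq'.2.2]
      · linarith [hq.1.1, hq'.1.2]
    · refine ⟨1, one_pos, (hlim.eventually_lt_const (half_pos hs)).mono fun k hk q hq hq' => ?_⟩
      rw [mem_halfOpenBox] at hq hq'
      dsimp only at hq'
      linarith [hq.1.1, hq.2.1, hq'.1.2, hq'.2.2]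
  obtain ⟨δ, hδ, hev⟩ := key
  obtain ⟨K, hK⟩ := Filter.eventually_atTop.1 hev
  have hO : IsOpen (halfOpenBox p δ ∩
      ⋂ k ∈ Finset.range K, (halfOpenBox (x k, -x k) (ε k))ᶜ) :=
    (sorgPlane_isClopen_halfOpenBox _ _).2.inter
      (isOpen_biInter_finset fun k _ => (sorgPlane_isClopen_halfOpenBox _ _).1.isOpen_compl)
  refine Filter.mem_of_superset (hO.mem_nhds ⟨self_mem_halfOpenBox p hδ,
    mem_iInter₂.2 fun k _ => hp k⟩) fun q hq => ?_
  rw [mem_compl_iff, mem_iUnion]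
  rintro ⟨k, hk⟩
  rcases lt_or_ge k K with h | h
  · exact mem_iInter₂.1 hq.2 k (Finset.mem_range.2 h) hk
  · exact hK k h q hq.1 hk

lemma functionallyClosedIn_sorgPlane_of_isGδ {x : ℕ → ℝ} (hx : IsGδ (range x)) :
    FunctionallyClosedIn sorgPlane (range fun k => (x k, -x k)) := by
  obtain ⟨V, hVo, hV⟩ := isGδ_iff_eq_iInter_nat.1 hx
  have hball : ∀ k, ∃ ε > 0, ∀ a, |x k - a| < ε → ∀ j ≤ k, a ∈ V j := fun k => by
    have hO : IsOpen (⋂ j ∈ Finset.range (k + 1), V j) :=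
      isOpen_biInter_finset fun j _ => hVo j
    have hxk : x k ∈ ⋂ j ∈ Finset.range (k + 1), V j := by
      have : x k ∈ ⋂ j, V j := hV ▸ mem_range_self k
      exact mem_iInter₂.2 fun j _ => mem_iInter.1 this j
    obtain ⟨ε, hε, h⟩ := Metric.isOpen_iff.1 hO _ hxk
    refine ⟨ε, hε, fun a ha j hj => ?_⟩
    refine mem_iInter₂.1 (h ?_) j (Finset.mem_range_succ_iff.2 hj)
    rwa [Metric.mem_ball, dist_comm, Real.dist_eq]
  choose ε hε hεV using hball
  set r : ℕ → ℕ → ℝ := fun m k => min (ε k) (1 / ((m + k : ℕ) + 1))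
  have hr0 : ∀ m k, 0 < r m k := fun m k => lt_min (hε k) Nat.one_div_pos_of_nat
  have hclopen : ∀ m, @IsClopen _ sorgPlane (⋃ k, halfOpenBox (x k, -x k) (r m k)) := fun m => by
    refine sorgPlane_isClopen_iUnion_halfOpenBox (hr0 m) ?_ fun a ha => ?_
    · have h1 : Filter.Tendsto (fun k : ℕ => (1 / ((m + k : ℕ) + 1) : ℝ)) Filter.atTop (𝓝 0) :=
        (tendsto_one_div_add_atTop_nhds_zero_nat (𝕜 := ℝ)).comp
          (Filter.tendsto_atTop_mono (fun k => Nat.le_add_left k m) Filter.tendsto_id)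
      exact squeeze_zero (fun k => (hr0 m k).le) (fun k => min_le_right _ _) h1
    · rw [hV, mem_iInter, not_forall] at ha
      obtain ⟨j, hj⟩ := ha
      filter_upwards [Filter.eventually_ge_atTop j] with k hk
      by_contra! hlt
      exact hj (hεV k a (hlt.trans_le (min_le_left _ _)) j hk)
  have hEq : (range fun k => (x k, -x k)) = ⋂ m, ⋃ k, halfOpenBox (x k, -x k) (r m k) := by
    ext p
    simp only [mem_iInter, mem_iUnion]
    constructor
    · rintro ⟨k, rfl⟩ m
      exact ⟨k, self_mem_halfOpenBox _ (hr0 m k)⟩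
    · intro hp
      have hp2 : p.2 = -p.1 := by
        have h1 : 0 ≤ p.1 + p.2 := by
          obtain ⟨k, hk⟩ := hp 0
          rw [mem_halfOpenBox] at hk
          dsimp only at hk
          linarith [hk.1.1, hk.2.1]
        have h2 : p.1 + p.2 ≤ 0 := by
          by_contra! hpos
          obtain ⟨m, hm⟩ := exists_nat_one_div_lt (half_pos hpos)
          obtain ⟨k, hk⟩ := hp m
          have h3 : r m k ≤ 1 / (m + 1) :=
            (min_le_right _ _).trans (Nat.one_div_le_one_div (Nat.le_add_right m k))
          rw [mem_halfOpenBox] at hk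
          dsimp only at hk
          linarith [hk.1.2, hk.2.2]
        linarith
      obtain ⟨k, hk⟩ := hp 0
      have hpe : p = (p.1, -p.1) := Prod.ext rfl hp2
      rw [hpe] at hk
      have hkx := eq_of_mem_halfOpenBox_antidiagonal hk
      exact ⟨k, Prod.ext hkx.symm (by rw [hp2, hkx])⟩
  rw [hEq]
  exact @functionallyClosedIn_iInter_isClopen _ sorgPlane _ hclopen

lemma exists_injective_forall_mem_of_infinite {α : Type*} {s : ℕ → Set α}
    (hs : ∀ n, (s n).Infinite) : ∃ c : ℕ → α, Function.Injective c ∧ ∀ n, c n ∈ s n := by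
  classical
  choose t hts htc using fun n => (hs n).exists_subset_card_eq (n + 1)
  obtain ⟨c, hc, hct⟩ := (Finset.all_card_le_biUnion_card_iff_exists_injective t).1 fun I => by
    rcases I.eq_empty_or_nonempty with rfl | hI
    · simp
    · calc I.card ≤ (Finset.range (I.max' hI + 1)).card :=
            Finset.card_le_card fun i hi => Finset.mem_range_succ_iff.2 (I.le_max' i hi)
        _ = (t (I.max' hI)).card := by rw [Finset.card_range, htc]
        _ ≤ (I.biUnion t).card :=
            Finset.card_le_card (Finset.subset_biUnion_of_mem t (I.max'_mem hI))
  exact ⟨c, hc, fun n => hts n (hct n)⟩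

/-- A nonempty set without isolated points in a second countable T₁ space splits into two
parts that are both dense in it. -/
lemma exists_subset_dense_codense {X : Type*} [TopologicalSpace X] [SecondCountableTopology X]
    [T1Space X] {A : Set X} (hA : A.Nonempty)
    (hacc : ∀ x ∈ A, ∀ V, IsOpen V → x ∈ V → ∃ y ∈ V ∩ A, y ≠ x) :
    ∃ F ⊆ A, A ⊆ closure F ∧ A ⊆ closure (A \ F) := by
  have hinf : ∀ V, IsOpen V → (V ∩ A).Nonempty → (V ∩ A).Infinite := by
    rintro V hV ⟨x, hxV, hxA⟩ hfin
    obtain ⟨y, ⟨⟨hyV, hy⟩, hyA⟩, hyx⟩ := hacc x hxA (V \ ((V ∩ A) \ {x}))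
      (hV.sdiff hfin.sdiff.isClosed) ⟨hxV, fun h => h.2 rfl⟩
    exact hy ⟨⟨hyV, hyA⟩, hyx⟩
  have hbasis := TopologicalSpace.isBasis_countableBasis X
  set S : Set (Set X) := {b ∈ TopologicalSpace.countableBasis X | (b ∩ A).Nonempty}
  have hScount : S.Countable := (TopologicalSpace.countable_countableBasis X).mono fun _ h => h.1
  have hSsub : ∀ x ∈ A, ∀ V, IsOpen V → x ∈ V → ∃ b ∈ S, b ⊆ V := fun x hx V hV hxV => by
    obtain ⟨b, hb, hxb, hbV⟩ := hbasis.exists_subset_of_mem_open hxV hV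
    exact ⟨b, ⟨hb, x, hxb, hx⟩, hbV⟩
  have hSne : S.Nonempty := by
    obtain ⟨x, hx⟩ := hA
    obtain ⟨b, hb, -⟩ := hSsub x hx univ isOpen_univ (mem_univ x)
    exact ⟨b, hb⟩
  obtain ⟨B, hB⟩ := hScount.exists_eq_range hSne
  have hBS : ∀ n, B n ∈ S := fun n => hB ▸ mem_range_self n
  obtain ⟨c, hc, hcB⟩ := exists_injective_forall_mem_of_infinite (s := fun n => B (n / 2) ∩ A)
    fun n => hinf _ (hbasis.isOpen (hBS _).1) (hBS _).2
  refine ⟨range fun n => c (2 * n), ?_, fun x hx => ?_, fun x hx => ?_⟩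
  · rintro _ ⟨n, rfl⟩
    exact (hcB _).2
  all_goals
    refine mem_closure_iff.2 fun V hV hxV => ?_
    obtain ⟨b, hb, hbV⟩ := hSsub x hx V hV hxV
    rw [hB] at hb
    obtain ⟨n, rfl⟩ := hb
  · refine ⟨c (2 * n), hbV ?_, n, rfl⟩
    have := (hcB (2 * n)).1
    rwa [show 2 * n / 2 = n by omega] at this
  · refine ⟨c (2 * n + 1), hbV ?_, (hcB _).2, ?_⟩
    · have := (hcB (2 * n + 1)).1
      rwa [show (2 * n + 1) / 2 = n by omega] at this
    · rintro ⟨m, hm⟩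
      have := hc hm
      omega

/-- In a complete metric space, two disjoint Gδ-sets cannot both be dense in the same
nonempty set. -/
lemma not_disjoint_of_isGδ_of_subset_closure {X : Type*} [MetricSpace X] [CompleteSpace X]
    {A F F' G G' : Set X} (hA : A.Nonempty) (hF : F ⊆ A) (hF' : F' ⊆ A) (hAF : A ⊆ closure F)
    (hAF' : A ⊆ closure F') (hG : IsGδ G) (hG' : IsGδ G') (hFG : F ⊆ G) (hFG' : F' ⊆ G') :
    ¬ Disjoint G G' := by
  have : CompleteSpace (closure A) := isClosed_closure.isComplete.completeSpace_coe
  have : Nonempty (closure A) := hA.closure.to_subtype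
  have hdense : ∀ H K : Set X, H ⊆ A → A ⊆ closure H → H ⊆ K →
      Dense ((↑) ⁻¹' K : Set (closure A)) := fun H K hHA hAH hHK x => by
    rw [closure_subtype]
    have hx : (x : X) ∈ closure H := closure_minimal hAH isClosed_closure x.2
    refine closure_mono (fun y hy => ?_) hx
    exact ⟨⟨y, subset_closure (hHA hy)⟩, hHK hy, rfl⟩
  obtain ⟨x, hx⟩ := ((hdense F G hF hAF hFG).inter_of_Gδ
    (hG.preimage continuous_subtype_val) (hG'.preimage continuous_subtype_val)
    (hdense F' G' hF' hAF' hFG')).nonempty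
  exact fun h => h.le_bot hx

/-- A scattered subset of a second countable metrizable space is a countable Gδ-set. -/
lemma countable_and_isGδ_of_scattered {X : Type*} [MetricSpace X] [SecondCountableTopology X]
    {E : Set X} (hE : ∀ A ⊆ E, A.Nonempty → ∃ x ∈ A, ∃ V, IsOpen V ∧ V ∩ A = {x}) :
    E.Countable ∧ IsGδ E := by
  set S : Set (Set X) := {U | IsOpen U ∧ (E ∩ U).Countable ∧ IsGδ (E ∪ Uᶜ)}
  obtain ⟨T, hTc, hTS, hTU⟩ := TopologicalSpace.isOpen_sUnion_countable S fun U hU => hU.1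
  have hopen : IsOpen (⋃₀ S) := isOpen_sUnion fun U hU => hU.1
  have hcount : (E ∩ ⋃₀ S).Countable := by
    rw [← hTU, sUnion_eq_biUnion, inter_iUnion₂]
    exact hTc.biUnion fun U hU => (hTS hU).2.1
  have hGδ : IsGδ (E ∪ (⋃₀ S)ᶜ) := by
    have : E ∪ (⋃₀ S)ᶜ = ⋂ U ∈ T, (E ∪ Uᶜ) := by
      rw [← hTU, sUnion_eq_biUnion, compl_iUnion₂, union_iInter₂]
    rw [this]
    exact .biInter hTc fun U hU => (hTS hU).2.2
  have hGδ' : IsGδ (E ∩ ⋃₀ S) := by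
    have : E ∩ ⋃₀ S = (E ∪ (⋃₀ S)ᶜ) ∩ ⋃₀ S := by
      rw [union_inter_distrib_right, compl_inter_self, union_empty]
    rw [this]
    exact hGδ.inter hopen.isGδ
  have hsub : E ⊆ ⋃₀ S := by
    by_contra hne
    obtain ⟨x, hx, V, hV, hVx⟩ := hE (E \ ⋃₀ S) sdiff_subset (sdiff_nonempty.2 hne)
    have hxV : x ∈ V := (hVx.symm ▸ mem_singleton x : x ∈ V ∩ (E \ ⋃₀ S)).1
    have hcase : ∀ y ∈ E, y ∈ V → y = x ∨ y ∈ E ∩ ⋃₀ S := fun y hy hyV => by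
      by_cases h : y ∈ ⋃₀ S
      · exact Or.inr ⟨hy, h⟩
      · exact Or.inl (hVx.subset ⟨hyV, hy, h⟩)
    refine hx.2 ⟨V, ⟨hV, ?_, ?_⟩, hxV⟩
    · exact ((countable_singleton x).union hcount).mono fun y hy => hcase y hy.1 hy.2
    · have : E ∪ Vᶜ = ({x} ∪ (E ∩ ⋃₀ S)) ∪ Vᶜ := by
        ext y
        constructor
        · rintro (hy | hy)
          · by_cases hyV : y ∈ V
            · exact Or.inl (hcase y hy hyV)
            · exact Or.inr hyV
          · exact Or.inr hy
        · rintro ((rfl | hy) | hy)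
          exacts [Or.inl hx.1, Or.inl hy.1, Or.inr hy]
      rw [this]
      exact ((IsGδ.singleton x).union hGδ').union hV.isClosed_compl.isGδ
  rw [inter_eq_left.2 hsub] at hcount hGδ'
  exact ⟨hcount, hGδ'⟩

lemma sorgPlane_continuous_of_subset_antidiagonal {E : Set (ℝ × ℝ)}
    (hE : E ⊆ {p : ℝ × ℝ | p.2 = -p.1}) (f : E → ℝ) :
    Continuous[sorgPlane.induced ((↑) : E → ℝ × ℝ), inferInstance] f := by
  let _ := sorgPlane.induced ((↑) : E → ℝ × ℝ)
  have : DiscreteTopology E := by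
    rw [discreteTopology_iff_isOpen_singleton]
    intro p
    refine (isOpen_induced_iff (t := sorgPlane)).2
      ⟨halfOpenBox p 1, (sorgPlane_isClopen_halfOpenBox _ _).2, ?_⟩
    ext q
    constructor
    · intro hq
      have hp' : (p : ℝ × ℝ) = (p.1.1, -p.1.1) := Prod.ext rfl (hE p.2)
      have hq' : (q : ℝ × ℝ) = (q.1.1, -q.1.1) := Prod.ext rfl (hE q.2)
      rw [mem_preimage, hp', hq'] at hq
      exact Subtype.ext (by rw [hp', hq', eq_of_mem_halfOpenBox_antidiagonal hq])
    · rintro rfl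
      exact self_mem_halfOpenBox _ one_pos
  exact continuous_of_discreteTopology

lemma scattered_of_cStarEmbedded {E : Set (ℝ × ℝ)} (hE : E ⊆ {p : ℝ × ℝ | p.2 = -p.1})
    (h : CStarEmbedded sorgPlane E) {A : Set ℝ} (hAE : ∀ x ∈ A, (x, -x) ∈ E)
    (hA : A.Nonempty) : ∃ x ∈ A, ∃ V, IsOpen V ∧ V ∩ A = {x} := by
  classical
  by_contra! hno
  obtain ⟨F, hFA, hF, hF'⟩ := exists_subset_dense_codense hA fun x hx V hV hxV => by
    by_contra! hall
    exact hno x hx V hV (Subset.antisymm hall (singleton_subset_iff.2 ⟨hxV, hx⟩))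
  obtain ⟨g, hg, hgf⟩ := h (fun p => if p.1.1 ∈ F then 0 else 1)
    (sorgPlane_continuous_of_subset_antidiagonal hE _)
    ⟨1, fun p => by split_ifs <;> simp⟩
  have hg1 : Continuous[sorgPlane, inferInstance] fun q => g q - 1 :=
    @Continuous.comp _ _ _ sorgPlane _ _ _ _ (continuous_sub_right (1 : ℝ)) hg
  refine not_disjoint_of_isGδ_of_subset_closure hA hFA sdiff_subset hF hF'
    (isGδ_antidiagonal_zeroSet hg) (isGδ_antidiagonal_zeroSet hg1) (fun x hx => ?_)
    (fun x hx => ?_) ?_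
  · simpa [hx] using hgf ⟨_, hAE x (hFA hx)⟩
  · have := hgf ⟨_, hAE x hx.1⟩
    simp only [hx.2, if_false] at this
    simp [this]
  · rw [Set.disjoint_left]
    intro x hx hx'
    simp only [mem_ofPred_eq] at hx hx'
    norm_num [hx] at hx'

lemma eq_image_of_subset_antidiagonal {E : Set (ℝ × ℝ)} (hE : E ⊆ {p : ℝ × ℝ | p.2 = -p.1}) :
    E = (fun x : ℝ => (x, -x)) '' {x | (x, -x) ∈ E} := by
  ext p
  constructor
  · intro hp
    have : p = (p.1, -p.1) := Prod.ext rfl (hE hp)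
    exact ⟨p.1, this ▸ hp, this.symm⟩
  · rintro ⟨x, hx, rfl⟩
    exact hx

lemma isGδ_of_subset_antidiagonal {E : Set (ℝ × ℝ)} (hE : E ⊆ {p : ℝ × ℝ | p.2 = -p.1})
    (h : IsGδ {x : ℝ | (x, -x) ∈ E}) : IsGδ E := by
  have hEq : E = {p : ℝ × ℝ | p.2 = -p.1} ∩ Prod.fst ⁻¹' {x : ℝ | (x, -x) ∈ E} := by
    ext p
    have hp : p.2 = -p.1 → p = (p.1, -p.1) := fun h => Prod.ext rfl h
    constructor
    · intro hpE
      exact ⟨hE hpE, by rw [mem_preimage, mem_ofPred_eq, ← hp (hE hpE)]; exact hpE⟩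
    · rintro ⟨h1, h2⟩
      rw [hp h1]
      exact h2
  rw [hEq]
  exact (isClosed_eq continuous_snd continuous_fst.neg).isGδ.inter (h.preimage continuous_fst)

lemma exists_seq_of_countable_subset_antidiagonal {E : Set (ℝ × ℝ)}
    (hE : E ⊆ {p : ℝ × ℝ | p.2 = -p.1}) (hc : E.Countable) (hne : E.Nonempty) :
    ∃ x : ℕ → ℝ, E = (range fun k => (x k, -x k)) ∧ {x | (x, -x) ∈ E} = range x := by
  have hinj : Function.Injective fun x : ℝ => (x, -x) := fun a b h => congrArg Prod.fst h
  have hc' : {x : ℝ | (x, -x) ∈ E}.Countable := hc.preimage hinj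
  have hne' : {x : ℝ | (x, -x) ∈ E}.Nonempty := by
    obtain ⟨p, hp⟩ := hne
    rw [eq_image_of_subset_antidiagonal hE] at hp
    obtain ⟨x, hx, -⟩ := hp
    exact ⟨x, hx⟩
  obtain ⟨x, hx⟩ := hc'.exists_eq_range hne'
  refine ⟨x, ?_, hx⟩
  conv_lhs => rw [eq_image_of_subset_antidiagonal hE, hx, ← range_comp]
  rfl

/-- For a subset of the anti-diagonal of the Sorgenfrey plane the following are equivalent:
C-embedded; C*-embedded; countable Euclidean-Gδ; countable and functionally closed in 𝕊². -/
theorem antidiagonal_embedding_tfae (E : Set (ℝ × ℝ))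
    (hE : E ⊆ {p : ℝ × ℝ | p.2 = -p.1}) :
    List.TFAE [CEmbedded sorgPlane E,
      CStarEmbedded sorgPlane E,
      E.Countable ∧ IsGδ E,
      E.Countable ∧ FunctionallyClosedIn sorgPlane E] := by
  tfae_have 1 → 2 := fun h f hf _ => h f hf
  tfae_have 2 → 3 := fun h => by
    obtain ⟨hc, hG⟩ := countable_and_isGδ_of_scattered (E := {x : ℝ | (x, -x) ∈ E})
      fun A hA hne => scattered_of_cStarEmbedded hE h hA hne
    refine ⟨?_, isGδ_of_subset_antidiagonal hE hG⟩
    rw [eq_image_of_subset_antidiagonal hE]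
    exact hc.image _
  tfae_have 3 → 4 := fun ⟨hc, hG⟩ => by
    refine ⟨hc, ?_⟩
    rcases E.eq_empty_or_nonempty with rfl | hne
    · exact ⟨fun _ => 1, @continuous_const _ _ sorgPlane _ 1, fun _ => by simp, by simp⟩
    obtain ⟨x, hEx, hx⟩ := exists_seq_of_countable_subset_antidiagonal hE hc hne
    have hGx : IsGδ {x : ℝ | (x, -x) ∈ E} :=
      hG.preimage (f := fun x : ℝ => (x, -x)) (by fun_prop)
    rw [hEx]
    exact functionallyClosedIn_sorgPlane_of_isGδ (hx ▸ hGx)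
  tfae_have 4 → 1 := fun ⟨hc, hF⟩ => by
    rcases E.eq_empty_or_nonempty with rfl | hne
    · exact fun f _ => ⟨fun _ => 0, @continuous_const _ _ sorgPlane _ 0, fun x => x.2.elim⟩
    obtain ⟨x, hEx, -⟩ := exists_seq_of_countable_subset_antidiagonal hE hc hne
    rw [hEx] at hF ⊢
    refine @cEmbedded_range_of_isClopen_separated _ sorgPlane _
      (fun k => halfOpenBox (x k, -x k) 1) (fun k => sorgPlane_isClopen_halfOpenBox _ _)
      (fun k => self_mem_halfOpenBox _ one_pos) (fun m n hmn => ?_) hF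
    simp only [eq_of_mem_halfOpenBox_antidiagonal hmn]
  tfae_finish
end
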